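/- arXiv:1510.08493 — 3 statements merged into one kernel-verified Lean document; each statement's English description precedes it below -/
import Mathlib

section
/- Let G = G₀ × Z be a finitely generated group with Z ≅ ℤ, and let H ≤ G be a quasi-isometrically embedded subgroup isomorphic to a finitely generated free group of rank ≥ 2. Then the composition H → G → G/Z (projection killing the Z factor) is a quasi-isometric embedding of H into G₀. -/
/-- The word length of `g` with respect to a (symmetrised) generating set `S`. -/
noncomputable def wordLength {G : Type*} [Group G] (S : Set G) (g : G) : ℕ :=
  sInf {n : ℕ | ∃ l : List G, (∀ x ∈ l, x ∈ S ∨ x⁻¹ ∈ S) ∧ l.length = n ∧ l.prod = g}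

/-- `f : G → H` is a quasi-isometric embedding for the word metrics given by
generating sets `S` of `G` and `T` of `H`. -/
def IsQIEmbedding {G H : Type*} [Group G] [Group H] (S : Set G) (T : Set H)
    (f : G → H) : Prop :=
  ∃ c : ℝ, 1 ≤ c ∧ ∃ b : ℝ, 0 ≤ b ∧ ∀ g g' : G,
    (wordLength S (g⁻¹ * g') : ℝ) / c - b ≤ (wordLength T ((f g)⁻¹ * f g') : ℝ) ∧
    (wordLength T ((f g)⁻¹ * f g') : ℝ) ≤ c * (wordLength S (g⁻¹ * g') : ℝ) + b

section WordLength

variable {G : Type*} [Group G] {S : Set G}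

theorem exists_list_length_eq_wordLength (hS : Subgroup.closure S = ⊤) (g : G) :
    ∃ l : List G, (∀ x ∈ l, x ∈ S ∨ x⁻¹ ∈ S) ∧ l.length = wordLength S g ∧ l.prod = g := by
  have hg : g ∈ Submonoid.closure (S ∪ S⁻¹) := by
    rw [← Subgroup.closure_toSubmonoid, hS]
    exact Subgroup.mem_top g
  obtain ⟨l, hl, hprod⟩ := Submonoid.exists_list_of_mem_closure hg
  exact Nat.sInf_mem (s := {n : ℕ | ∃ l : List G, (∀ x ∈ l, x ∈ S ∨ x⁻¹ ∈ S) ∧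
    l.length = n ∧ l.prod = g}) ⟨l.length, l, hl, rfl, hprod⟩

theorem wordLength_prod_le {l : List G} (hl : ∀ x ∈ l, x ∈ S ∨ x⁻¹ ∈ S) :
    wordLength S l.prod ≤ l.length :=
  Nat.sInf_le ⟨l, hl, rfl, rfl⟩

theorem wordLength_one : wordLength S 1 = 0 :=
  Nat.le_zero.1 (wordLength_prod_le (l := []) (by simp))

theorem wordLength_mul_le (hS : Subgroup.closure S = ⊤) (g h : G) :
    wordLength S (g * h) ≤ wordLength S g + wordLength S h := by
  obtain ⟨l, hl, hlen, rfl⟩ := exists_list_length_eq_wordLength hS g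
  obtain ⟨m, hm, hmen, rfl⟩ := exists_list_length_eq_wordLength hS h
  rw [← hlen, ← hmen, ← List.prod_append, ← List.length_append]
  refine wordLength_prod_le fun x hx => ?_
  exact (List.mem_append.1 hx).elim (hl x) (hm x)

theorem wordLength_inv_le (hS : Subgroup.closure S = ⊤) (g : G) :
    wordLength S g⁻¹ ≤ wordLength S g := by
  obtain ⟨l, hl, hlen, rfl⟩ := exists_list_length_eq_wordLength hS g
  rw [← hlen, List.prod_inv_reverse]
  refine (wordLength_prod_le fun x hx => ?_).trans_eq (by simp)
  obtain ⟨y, hy, rfl⟩ := List.mem_map.1 (List.mem_reverse.1 hx)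
  simpa [or_comm] using hl y hy

theorem wordLength_inv (hS : Subgroup.closure S = ⊤) (g : G) :
    wordLength S g⁻¹ = wordLength S g :=
  (wordLength_inv_le hS g).antisymm (by simpa using wordLength_inv_le hS g⁻¹)

/-- A length function on a group is at most linear in any finite word length. -/
theorem exists_le_mul_wordLength (hfin : S.Finite) (hS : Subgroup.closure S = ⊤)
    (N : G → ℕ) (h_one : N 1 = 0) (h_mul : ∀ g h, N (g * h) ≤ N g + N h)
    (h_inv : ∀ g, N g⁻¹ = N g) : ∃ K : ℕ, ∀ g, N g ≤ K * wordLength S g := by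
  obtain ⟨K, hK⟩ := (hfin.image N).bddAbove
  refine ⟨K, fun g => ?_⟩
  obtain ⟨l, hl, hlen, rfl⟩ := exists_list_length_eq_wordLength hS g
  rw [← hlen]
  clear hlen
  induction l with
  | nil => simp [h_one]
  | cons a l ih =>
    have ha : N a ≤ K := by
      rcases hl a (by simp) with h | h
      · exact hK ⟨a, h, rfl⟩
      · exact h_inv a ▸ hK ⟨a⁻¹, h, rfl⟩
    have hl' := ih fun x hx => hl x (List.mem_cons_of_mem _ hx)
    rw [List.prod_cons, List.length_cons, mul_add, mul_one]
    exact (h_mul _ _).trans (by omega)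

theorem exists_wordLength_map_le {G' : Type*} [Group G'] {T : Set G'} (hfin : S.Finite)
    (hS : Subgroup.closure S = ⊤) (hT : Subgroup.closure T = ⊤) (f : G →* G') :
    ∃ K : ℕ, ∀ g, wordLength T (f g) ≤ K * wordLength S g :=
  exists_le_mul_wordLength hfin hS (fun g => wordLength T (f g)) (by simp [wordLength_one])
    (fun g h => by simpa using wordLength_mul_le hT (f g) (f h))
    (fun g => by simpa using wordLength_inv hT (f g))

theorem wordLength_conj_le (hS : Subgroup.closure S = ⊤) (g h : G) :
    wordLength S (g * h * g⁻¹) ≤ 2 * wordLength S g + wordLength S h := by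
  have h₁ := wordLength_mul_le hS (g * h) g⁻¹
  have h₂ := wordLength_mul_le hS g h
  rw [wordLength_inv hS] at h₁
  omega

end WordLength

namespace FreeGroup

variable {α : Type*} [DecidableEq α]

theorem wordLength_range_of_le_norm (w : FreeGroup α) :
    wordLength (Set.range (of : α → FreeGroup α)) w ≤ norm w := by
  have key : ∀ L : List (α × Bool),
      wordLength (Set.range (of : α → FreeGroup α)) (mk L) ≤ L.length := by
    intro L
    induction L with
    | nil => exact wordLength_one.le
    | cons a L ih =>
      have ha : wordLength (Set.range (of : α → FreeGroup α)) (mk [a]) ≤ 1 := by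
        refine (congrArg _ (by simp)).trans_le (wordLength_prod_le (l := [mk [a]]) ?_)
        rintro x hx
        obtain rfl := List.mem_singleton.1 hx
        obtain ⟨i, b⟩ := a
        cases b
        · exact Or.inr ⟨i, by simp [of, invRev]⟩
        · exact Or.inl ⟨i, rfl⟩
      have h := wordLength_mul_le (closure_range_of α) (mk [a]) (mk L)
      rw [mul_mk, List.singleton_append] at h
      rw [List.length_cons]
      omega
  simpa only [mk_toWord, norm] using key w.toWord

/-- Conjugating a suitable generator by `w` produces no cancellation. -/
theorem exists_norm_conj_of_eq [Nontrivial α] (w : FreeGroup α) :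
    ∃ a : α, norm (w * of a * w⁻¹) = 2 * norm w + 1 := by
  obtain ⟨a, ha⟩ : ∃ a : α, ∀ x ∈ w.toWord.getLast?, x.1 ≠ a := by
    cases h : w.toWord.getLast? with
    | none => exact ⟨Classical.arbitrary α, by simp⟩
    | some x =>
      obtain ⟨a, ha⟩ := exists_ne x.1
      exact ⟨a, by simpa using ha.symm⟩
  refine ⟨a, ?_⟩
  have hred : IsReduced (w.toWord ++ [(a, true)] ++ invRev w.toWord) := by
    have h₁ : IsReduced w.toWord := isReduced_toWord
    have h₂ : IsReduced (invRev w.toWord) := toWord_inv w ▸ isReduced_toWord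
    have hhead : ∀ y ∈ (invRev w.toWord).head?, y.1 ≠ a := by
      intro y hy
      simp only [invRev, List.head?_reverse, List.getLast?_map, Option.mem_map] at hy
      obtain ⟨x, hx, rfl⟩ := hy
      exact ha x hx
    unfold IsReduced at *
    rw [List.isChain_append, List.isChain_append]
    refine ⟨⟨h₁, by simp, ?_⟩, h₂, ?_⟩
    · intro x hx y hy h
      obtain rfl : (a, true) = y := by simpa using hy
      exact absurd h (ha x hx)
    · intro x hx y hy h
      obtain rfl : (a, true) = x := by simpa using hx
      exact absurd h.symm (hhead y hy)
  have heq : w * of a * w⁻¹ = mk (w.toWord ++ [(a, true)] ++ invRev w.toWord) := by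
    rw [← mul_mk, ← mul_mk, ← inv_mk, mk_toWord, of]
  rw [heq, norm, toWord_mk, hred.reduce_eq]
  simp only [List.length_append, invRev_length, List.length_singleton, norm]
  omega

end FreeGroup

/-- let `G = G₀ × ℤ` be finitely generated and `H ≤ G` a quasi-isometrically
embedded subgroup isomorphic to a free group of rank `k ≥ 2`. Then the coordinate
projection to `G₀`, restricted to `H`, is a quasi-isometric embedding. -/
theorem free_subgroup_projection_qi {G₀ : Type*} [Group G₀]
    (S₀ : Set G₀) (hS₀fin : S₀.Finite) (hS₀gen : Subgroup.closure S₀ = ⊤)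
    (S : Set (G₀ × Multiplicative ℤ)) (hSfin : S.Finite) (hSgen : Subgroup.closure S = ⊤)
    (H : Subgroup (G₀ × Multiplicative ℤ))
    (k : ℕ) (hk : 2 ≤ k) (φ : H ≃* FreeGroup (Fin k))
    (SH : Set H) (hSHfin : SH.Finite) (hSHgen : Subgroup.closure SH = ⊤)
    (hqi : IsQIEmbedding SH S (fun h : H => (h : G₀ × Multiplicative ℤ))) :
    IsQIEmbedding SH S₀ (fun h : H => ((h : G₀ × Multiplicative ℤ)).1) := by
  obtain ⟨c, hc, b, hb, hqi⟩ := hqi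
  have : Nontrivial (Fin k) := Fin.nontrivial_iff_two_le.2 hk
  obtain ⟨K₁, hK₁⟩ := exists_wordLength_map_le (Set.finite_range FreeGroup.of)
    (FreeGroup.closure_range_of (Fin k)) hSHgen φ.symm.toMonoidHom
  obtain ⟨K₂, hK₂⟩ := exists_le_mul_wordLength hSHfin hSHgen (fun h => (φ h).norm) (by simp)
    (fun g h => by simpa using FreeGroup.norm_mul_le (φ g) (φ h)) (fun g => by simp)
  obtain ⟨K₃, hK₃⟩ := exists_wordLength_map_le hS₀fin hS₀gen hSgen
    (MonoidHom.inl G₀ (Multiplicative ℤ))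
  obtain ⟨K, hK⟩ := exists_wordLength_map_le hSHfin hSHgen hS₀gen
    ((MonoidHom.fst G₀ (Multiplicative ℤ)).comp H.subtype)
  let t : Fin k → G₀ × Multiplicative ℤ := fun j => φ.symm (FreeGroup.of j)
  obtain ⟨M, hM⟩ := (Set.finite_range fun j => wordLength S (1, (t j).2)).bddAbove
  obtain ⟨M', hM'⟩ := (Set.finite_range fun j => wordLength S₀ (t j).1).bddAbove
  have key : ∀ x : H, (wordLength SH x : ℝ) ≤ K₁ * K₂ * c * (2 * K₃) * wordLength S₀ x.1.1 +
      K₁ * K₂ * c * (K₃ * M' + M + b) := by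
    intro x
    obtain ⟨j, hj⟩ := FreeGroup.exists_norm_conj_of_eq (φ x)
    set y : H := x * φ.symm (FreeGroup.of j) * x⁻¹ with hy
    have hyx : (φ x).norm ≤ K₂ * wordLength SH y := by
      have : φ y = φ x * FreeGroup.of j * (φ x)⁻¹ := by simp [hy]
      have := (this ▸ hK₂ y : _ ≤ _)
      omega
    have hx : wordLength SH x ≤ K₁ * (φ x).norm := by
      have h := hK₁ (φ x)
      simp only [MulEquiv.toMonoidHom_eq_coe, MonoidHom.coe_coe, MulEquiv.symm_apply_apply] at h
      exact h.trans (Nat.mul_le_mul_left _ (FreeGroup.wordLength_range_of_le_norm _))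
    have hy₁ : wordLength S₀ y.1.1 ≤ 2 * wordLength S₀ x.1.1 + M' :=
      (wordLength_conj_le hS₀gen x.1.1 (t j).1).trans
        (Nat.add_le_add_left (hM' ⟨j, rfl⟩) _)
    have hy₂ : wordLength S y.1 ≤ K₃ * wordLength S₀ y.1.1 + M := by
      have hsplit : y.1 = MonoidHom.inl G₀ (Multiplicative ℤ) y.1.1 * (1, (t j).2) := by
        ext
        · simp
        · simp [hy, t, mul_comm]
      have h := wordLength_mul_le hSgen (MonoidHom.inl G₀ (Multiplicative ℤ) y.1.1) (1, (t j).2)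
      rw [← hsplit] at h
      exact h.trans (Nat.add_le_add (hK₃ _) (hM ⟨j, rfl⟩))
    have hy₃ : (wordLength SH y : ℝ) ≤ c * (wordLength S y.1 + b) := by
      have h := (hqi 1 y).1
      simp only [inv_one, one_mul, OneMemClass.coe_one] at h
      rw [sub_le_iff_le_add, div_le_iff₀ (by linarith)] at h
      linarith
    calc (wordLength SH x : ℝ) ≤ K₁ * (K₂ * wordLength SH y) := by
          exact_mod_cast hx.trans (Nat.mul_le_mul_left _ hyx)
      _ ≤ K₁ * (K₂ * (c * (wordLength S y.1 + b))) := by gcongr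
      _ ≤ K₁ * (K₂ * (c * ((K₃ * (2 * wordLength S₀ x.1.1 + M') + M : ℕ) + b))) := by
          have := hy₂.trans (Nat.add_le_add_right (Nat.mul_le_mul_left K₃ hy₁) M)
          gcongr
      _ = _ := by push_cast; ring
  set A : ℝ := K₁ * K₂ * c * (2 * K₃)
  set D : ℝ := K₁ * K₂ * c * (K₃ * M' + M + b)
  have hD : 0 ≤ D := by positivity
  refine ⟨max 1 (max A K), le_max_left _ _, D, hD, fun g g' => ?_⟩
  have hproj : (g.1.1)⁻¹ * g'.1.1 = (g⁻¹ * g').1.1 := rfl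
  rw [hproj]
  have h_lower := key (g⁻¹ * g')
  have h_upper : (wordLength S₀ (g⁻¹ * g').1.1 : ℝ) ≤ K * wordLength SH (g⁻¹ * g') := by
    exact_mod_cast hK (g⁻¹ * g')
  have h₁ : (1 : ℝ) ≤ max 1 (max A K) := le_max_left _ _
  have hA : A ≤ max 1 (max A K) := (le_max_left _ _).trans (le_max_right _ _)
  have hKm : (K : ℝ) ≤ max 1 (max A K) := (le_max_right _ _).trans (le_max_right _ _)
  constructor
  · rw [sub_le_iff_le_add, div_le_iff₀ (by linarith)]
    calc (wordLength SH (g⁻¹ * g') : ℝ) ≤ A * wordLength S₀ (g⁻¹ * g').1.1 + D := h_lower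
      _ ≤ max 1 (max A K) * wordLength S₀ (g⁻¹ * g').1.1 + max 1 (max A K) * D := by
          gcongr
          exact le_mul_of_one_le_left hD h₁
      _ = _ := by ring
  · exact (h_upper.trans (by gcongr)).trans (le_add_of_nonneg_right hD)
end

section
/- Let A be the two-generator Artin group A_n = ⟨a,b | (aba⋯)_n = (bab⋯)_n⟩ with n > 2. Then A has a finite-index subgroup isomorphic to F_k × ℤ for some k ≥ 2, where F_k is a free group of rank k; moreover no nonzero power of a or of b lies in the ℤ factor of this subgroup. -/
/-- The alternating product `x y x y ⋯` of length `n`. -/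
def altG {G : Type*} [Monoid G] : ℕ → G → G → G
  | 0, _, _ => 1
  | n + 1, x, y => x * altG n y x

lemma map_altG {M N : Type*} [Monoid M] [Monoid N] (f : M →* N) :
    ∀ (n : ℕ) (x y : M), f (altG n x y) = altG n (f x) (f y)
  | 0, _, _ => by simp [altG]
  | n + 1, x, y => by simp [altG, map_altG f n]

/-- The braid relation of the two-generator Artin group with exponent `n`. -/
def braidRels (n : ℕ) : Set (FreeGroup Bool) :=
  {altG n (FreeGroup.of true) (FreeGroup.of false) *
    (altG n (FreeGroup.of false) (FreeGroup.of true))⁻¹}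

/-- The two-generator Artin group `A_n`. -/
abbrev ArtinTwo (n : ℕ) := PresentedGroup (braidRels n)

/-- The generator `a`. -/
def artinA (n : ℕ) : ArtinTwo n := PresentedGroup.of true

/-- The generator `b`. -/
def artinB (n : ℕ) : ArtinTwo n := PresentedGroup.of false

/-- The Garside element `Δ = (aba⋯)_n`. -/
def artinDelta (n : ℕ) : ArtinTwo n := altG n (artinA n) (artinB n)

/-- The homomorphism `A_n → ℤ/2` sending both generators to `1`. -/
def toZ2 (n : ℕ) : ArtinTwo n →* Multiplicative (ZMod 2) :=
  PresentedGroup.toGroup (f := fun _ => Multiplicative.ofAdd 1) (by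
    intro r hr
    simp only [braidRels, Set.mem_singleton_iff] at hr
    subst hr
    simp [map_altG])

/-- The index-two subgroup `A_n'` of even-length words. -/
def AnPrime (n : ℕ) : Subgroup (ArtinTwo n) := (toZ2 n).ker

section AlternatingProducts

variable {G : Type*}

lemma altG_succ_right [Monoid G] :
    ∀ (k : ℕ) (x y : G), altG (k + 1) x y = altG k x y * if Even k then x else y
  | 0, x, y => by simp [altG]
  | k + 1, x, y => by
    rw [altG, altG_succ_right k y x, altG, mul_assoc]
    by_cases h : Even k <;> simp [Nat.even_add_one, h]

lemma altG_self [Monoid G] (x : G) : ∀ k : ℕ, altG k x x = x ^ k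
  | 0 => by simp [altG]
  | k + 1 => by rw [altG, altG_self x k, pow_succ']

/-- If `s` exchanges `x` and `y` by conjugation, then it exchanges their alternating products. -/
lemma SemiconjBy.altG [Monoid G] {s x y : G} (hxy : SemiconjBy s x y) (hyx : SemiconjBy s y x) :
    ∀ k : ℕ, SemiconjBy s (altG k x y) (altG k y x)
  | 0 => SemiconjBy.one_right s
  | k + 1 => hxy.mul_right (SemiconjBy.altG hyx hxy k)

lemma altG_mul_pow [Monoid G] {s x y : G} (hxy : SemiconjBy s x y) (hyx : SemiconjBy s y x) :
    ∀ k : ℕ, altG k x y * s ^ k = (x * s) ^ k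
  | 0 => by simp [altG]
  | k + 1 => by
    rw [pow_succ' (x * s), ← altG_mul_pow hxy hyx k, altG, pow_succ' s]
    simp only [mul_assoc]
    rw [← mul_assoc s (altG k x y), (hxy.altG hyx k).eq, mul_assoc]

/-- The square of the common alternating product commutes with each generator. -/
lemma commute_altG_sq [Monoid G] {n : ℕ} {x y : G} (h : altG n x y = altG n y x) :
    Commute (altG n x y ^ 2) x := by
  have hx : x * altG n x y = altG n x y * if Even n then x else y := by
    rw [← altG_succ_right, altG, h]
  have hy : y * altG n x y = altG n x y * if Even n then y else x := by
    conv_rhs => rw [h]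
    rw [← altG_succ_right, altG]
  have key : x * (altG n x y * altG n x y) = altG n x y * altG n x y * x := by
    rw [← mul_assoc, hx]
    split_ifs at hx hy ⊢
    · rw [mul_assoc, hx, mul_assoc]
    · rw [mul_assoc, hy, mul_assoc]
  rw [pow_two]
  exact key.symm

/-- The quotient of the two alternating products of length `k`. -/
def altQuot [Group G] (k : ℕ) (x y : G) : G := altG k x y * (altG k y x)⁻¹

lemma map_altQuot {G' : Type*} [Group G] [Group G'] (f : G →* G') (k : ℕ) (x y : G) :
    f (altQuot k x y) = altQuot k (f x) (f y) := by
  simp [altQuot, map_altG]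

lemma altQuot_zero [Group G] (x y : G) : altQuot 0 x y = 1 := by simp [altQuot, altG]

lemma altQuot_one [Group G] (x y : G) : altQuot 1 x y = x * y⁻¹ := by simp [altQuot, altG]

lemma conj_altQuot [Group G] (k : ℕ) (x y : G) :
    y * altQuot k x y * y⁻¹ = (altQuot (k + 1) x y)⁻¹ * altQuot 1 x y := by
  simp only [altQuot, altG]
  group

end AlternatingProducts

section FiberMonodromy

/-- The element of the free group of rank `n - 1` which will be the value of `altQuot k`. -/
def fiberElt (n k : ℕ) : FreeGroup (Fin (n - 1)) :=
  if h : 0 < k ∧ k < n then FreeGroup.of ⟨k - 1, by omega⟩ else 1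

lemma fiberElt_zero (n : ℕ) : fiberElt n 0 = 1 := by simp [fiberElt]

lemma fiberElt_self (n : ℕ) : fiberElt n n = 1 := by simp [fiberElt]

lemma fiberElt_succ {n : ℕ} (i : Fin (n - 1)) : fiberElt n (i + 1) = FreeGroup.of i := by
  have : (i : ℕ) + 1 < n := by omega
  simp [fiberElt, this]

lemma lift_fiberElt {n : ℕ} {G : Type*} [Group G] (r : ℕ → G) (h0 : r 0 = 1) (hn : r n = 1)
    {k : ℕ} (hk : k ≤ n) :
    FreeGroup.lift (fun i : Fin (n - 1) => r (i + 1)) (fiberElt n k) = r k := by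
  rcases Nat.eq_zero_or_pos k with rfl | hk0
  · simp [fiberElt_zero, h0]
  · rcases hk.eq_or_lt with rfl | hkn
    · simp [fiberElt_self, hn]
    · have := fiberElt_succ (n := n) ⟨k - 1, by omega⟩
      simp only [Nat.sub_add_cancel hk0] at this
      rw [this, FreeGroup.lift_apply_of]
      simp only [Nat.sub_add_cancel hk0]

/-- The monodromy on the free group of rank `n - 1`, as an endomorphism. -/
def monodromyHom (n : ℕ) : FreeGroup (Fin (n - 1)) →* FreeGroup (Fin (n - 1)) :=
  FreeGroup.lift fun i => (fiberElt n (i + 1 + 1))⁻¹ * fiberElt n 1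

/-- The inverse of the monodromy. -/
def monodromyInv (n : ℕ) : FreeGroup (Fin (n - 1)) →* FreeGroup (Fin (n - 1)) :=
  FreeGroup.lift fun i => fiberElt n (n - 1) * (fiberElt n (i + 1 - 1))⁻¹

lemma monodromyHom_fiberElt {n k : ℕ} (hk : k < n) :
    monodromyHom n (fiberElt n k) = (fiberElt n (k + 1))⁻¹ * fiberElt n 1 := by
  rcases Nat.eq_zero_or_pos k with rfl | hk0
  · simp [fiberElt_zero]
  · have := fiberElt_succ (n := n) ⟨k - 1, by omega⟩
    simp only [Nat.sub_add_cancel hk0] at this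
    rw [this, monodromyHom, FreeGroup.lift_apply_of]
    simp only [Nat.sub_add_cancel hk0]

lemma monodromyInv_fiberElt {n k : ℕ} (hk0 : 0 < k) (hk : k ≤ n) :
    monodromyInv n (fiberElt n k) = fiberElt n (n - 1) * (fiberElt n (k - 1))⁻¹ := by
  rcases hk.eq_or_lt with rfl | hkn
  · simp [fiberElt_self]
  · have := fiberElt_succ (n := n) ⟨k - 1, by omega⟩
    simp only [Nat.sub_add_cancel hk0] at this
    rw [this, monodromyInv, FreeGroup.lift_apply_of]
    simp only [Nat.sub_add_cancel hk0]

/-- The monodromy of the fibration `A_n → ℤ`. -/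
def monodromy (n : ℕ) (hn : 2 < n) : MulAut (FreeGroup (Fin (n - 1))) :=
  MonoidHom.toMulEquiv (monodromyHom n) (monodromyInv n)
    (by
      ext i
      have hi : (i : ℕ) + 1 < n := by omega
      rw [MonoidHom.comp_apply, ← fiberElt_succ, monodromyHom_fiberElt hi, map_mul, map_inv,
        monodromyInv_fiberElt (by omega) (by omega), monodromyInv_fiberElt (by omega) (by omega)]
      simp [fiberElt_zero])
    (by
      ext i
      have hi : (i : ℕ) + 1 < n := by omega
      have hn1 : n - 1 + 1 = n := by omega
      rw [MonoidHom.comp_apply, ← fiberElt_succ, monodromyInv_fiberElt (by omega) (by omega),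
        map_mul, map_inv, monodromyHom_fiberElt (by omega), monodromyHom_fiberElt (by omega), hn1]
      simp [fiberElt_self])

lemma monodromy_apply {n : ℕ} (hn : 2 < n) (f : FreeGroup (Fin (n - 1))) :
    monodromy n hn f = monodromyHom n f := rfl

end FiberMonodromy

namespace ArtinTwo

variable {n : ℕ}

/-- Two elements satisfying the braid relation define a homomorphism from `A_n`. -/
def lift {G : Type*} [Group G] (x y : G) (h : altG n x y = altG n y x) : ArtinTwo n →* G :=
  PresentedGroup.toGroup (f := fun i => cond i x y) (by
    intro r hr
    simp only [braidRels, Set.mem_singleton_iff] at hr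
    subst hr
    simp [map_altG, h])

@[simp]
lemma lift_artinA {G : Type*} [Group G] (x y : G) (h : altG n x y = altG n y x) :
    lift x y h (artinA n) = x :=
  PresentedGroup.toGroup.of _

@[simp]
lemma lift_artinB {G : Type*} [Group G] (x y : G) (h : altG n x y = altG n y x) :
    lift x y h (artinB n) = y :=
  PresentedGroup.toGroup.of _

lemma braid (n : ℕ) : altG n (artinA n) (artinB n) = altG n (artinB n) (artinA n) := by
  have h : PresentedGroup.mk (braidRels n) _ = 1 :=
    PresentedGroup.one_of_mem (rels := braidRels n) (Set.mem_singleton _)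
  rw [map_mul, map_inv, map_altG, map_altG] at h
  exact mul_inv_eq_one.mp h

lemma eq_top_of_mem {S : Subgroup (ArtinTwo n)} (ha : artinA n ∈ S) (hb : artinB n ∈ S) :
    S = ⊤ := by
  rw [eq_top_iff, ← PresentedGroup.closure_range_of, Subgroup.closure_le]
  rintro _ ⟨_ | _, rfl⟩
  · exact hb
  · exact ha

lemma artinDelta_sq_mem_center (n : ℕ) : artinDelta n ^ 2 ∈ Subgroup.center (ArtinTwo n) := by
  have ha : Commute (artinDelta n ^ 2) (artinA n) := commute_altG_sq (braid n)
  have hb : Commute (artinDelta n ^ 2) (artinB n) := by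
    rw [artinDelta, braid n]
    exact commute_altG_sq (braid n).symm
  have := eq_top_of_mem (S := Subgroup.centralizer {artinDelta n ^ 2})
    (Subgroup.mem_centralizer_singleton_iff.mpr ha.symm.eq)
    (Subgroup.mem_centralizer_singleton_iff.mpr hb.symm.eq)
  rw [Subgroup.mem_center_iff]
  intro g
  exact Subgroup.mem_centralizer_singleton_iff.mp (this ▸ Subgroup.mem_top g)

/-- The length homomorphism. -/
def length (n : ℕ) : ArtinTwo n →* Multiplicative ℤ :=
  lift (Multiplicative.ofAdd 1) (Multiplicative.ofAdd 1) rfl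

lemma length_artinDelta_sq (n : ℕ) :
    length n (artinDelta n ^ 2) = Multiplicative.ofAdd (2 * n : ℤ) := by
  rw [map_pow, artinDelta, map_altG, length, lift_artinA, lift_artinB, altG_self, ← pow_mul,
    ← ofAdd_nsmul]
  congr 1
  push_cast [nsmul_eq_mul]
  ring

/-- The inclusion of the fiber, the kernel of the length homomorphism, in `A_n`. -/
def fiberIncl (n : ℕ) : FreeGroup (Fin (n - 1)) →* ArtinTwo n :=
  FreeGroup.lift fun i => altQuot (i + 1) (artinA n) (artinB n)

lemma fiberIncl_fiberElt {k : ℕ} (hk : k ≤ n) :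
    fiberIncl n (fiberElt n k) = altQuot k (artinA n) (artinB n) :=
  lift_fiberElt (fun k => altQuot k (artinA n) (artinB n)) (altQuot_zero _ _)
    (by simp [altQuot, braid]) hk

lemma length_fiberIncl (f : FreeGroup (Fin (n - 1))) : length n (fiberIncl n f) = 1 := by
  have : (length n).comp (fiberIncl n) = 1 := by
    ext i
    rw [MonoidHom.comp_apply, fiberIncl, FreeGroup.lift_apply_of, map_altQuot, length,
      lift_artinA, lift_artinB]
    simp [altQuot]
  exact DFunLike.congr_fun this f

lemma fiberIncl_monodromy (hn : 2 < n) (f : FreeGroup (Fin (n - 1))) :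
    fiberIncl n (monodromy n hn f) = artinB n * fiberIncl n f * (artinB n)⁻¹ := by
  have : (fiberIncl n).comp (monodromyHom n) =
      (MulAut.conj (artinB n)).toMonoidHom.comp (fiberIncl n) := by
    ext i
    have hi : (i : ℕ) + 1 < n := by omega
    simp only [MonoidHom.comp_apply, MulEquiv.coe_toMonoidHom, MulAut.conj_apply]
    rw [← fiberElt_succ, monodromyHom_fiberElt hi, map_mul, map_inv, fiberIncl_fiberElt hi,
      fiberIncl_fiberElt (by omega), fiberIncl_fiberElt hi.le, conj_altQuot]
  exact DFunLike.congr_fun this f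

lemma exists_fiberIncl_mul_zpow (hn : 2 < n) (g : ArtinTwo n) :
    ∃ (f : FreeGroup (Fin (n - 1))) (m : ℤ), fiberIncl n f * artinB n ^ m = g := by
  have hab : artinA n * (artinB n)⁻¹ ∈ (fiberIncl n).range :=
    ⟨fiberElt n 1, by rw [fiberIncl_fiberElt (by omega), altQuot_one]⟩
  have hb : artinB n ∈ Subgroup.normalizer ((fiberIncl n).range : Set (ArtinTwo n)) := by
    rw [Subgroup.mem_normalizer_iff]
    intro g
    constructor
    · rintro ⟨f, rfl⟩
      exact ⟨_, fiberIncl_monodromy hn f⟩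
    · rintro ⟨f, hf⟩
      refine ⟨(monodromy n hn)⁻¹ f, ?_⟩
      have h := fiberIncl_monodromy hn ((monodromy n hn)⁻¹ f)
      rw [MulAut.apply_inv_self, hf] at h
      exact (mul_left_cancel (mul_right_cancel h)).symm
  have ha : artinA n ∈ Subgroup.normalizer ((fiberIncl n).range : Set (ArtinTwo n)) := by
    simpa using mul_mem (Subgroup.le_normalizer hab) hb
  have : (fiberIncl n).range.Normal := Subgroup.normalizer_eq_top_iff.mp (eq_top_of_mem ha hb)
  have hbz : artinB n ∈ (fiberIncl n).range ⊔ Subgroup.zpowers (artinB n) :=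
    Subgroup.mem_sup_right (Subgroup.mem_zpowers _)
  have htop := eq_top_of_mem (by simpa using mul_mem (Subgroup.mem_sup_left hab) hbz) hbz
  obtain ⟨_, ⟨f, rfl⟩, _, ⟨m, rfl⟩, h⟩ :=
    Subgroup.mem_sup_of_normal_left.mp (htop ▸ Subgroup.mem_top g)
  exact ⟨f, m, h⟩

lemma mem_range_fiberIncl (hn : 2 < n) {g : ArtinTwo n} (hg : length n g = 1) :
    g ∈ (fiberIncl n).range := by
  obtain ⟨f, m, rfl⟩ := exists_fiberIncl_mul_zpow hn g
  rw [map_mul, length_fiberIncl, one_mul, map_zpow, length, lift_artinB, ← ofAdd_zsmul] at hg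
  have hm : m = 0 := by simpa using hg
  exact ⟨f, by simp [hm]⟩

lemma fiberIncl_injective (hn : 2 < n) : Function.Injective (fiberIncl n) := by
  let act := zpowersHom (MulAut (FreeGroup (Fin (n - 1)))) (monodromy n hn)
  let t : FreeGroup (Fin (n - 1)) ⋊[act] Multiplicative ℤ :=
    SemidirectProduct.inr (Multiplicative.ofAdd 1)
  let x : FreeGroup (Fin (n - 1)) ⋊[act] Multiplicative ℤ :=
    SemidirectProduct.inl (fiberElt n 1) * t
  have ht (f) : t * SemidirectProduct.inl f * t⁻¹ = SemidirectProduct.inl (monodromy n hn f) := by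
    rw [← map_inv, ← SemidirectProduct.inl_aut]
    simp [act]
  have hquot : ∀ k ≤ n, altQuot k x t = SemidirectProduct.inl (fiberElt n k) := by
    intro k
    induction k with
    | zero => simp [altQuot_zero, fiberElt_zero]
    | succ k ih =>
      intro hk
      have h := conj_altQuot k x t
      rw [ih (by omega), ht, monodromy_apply, monodromyHom_fiberElt (by omega), altQuot_one,
        map_mul, mul_inv_cancel_right] at h
      simpa using (mul_right_cancel h).symm
  have hbraid : altG n x t = altG n t x := by
    have := hquot n le_rfl
    rwa [fiberElt_self, map_one, altQuot, mul_inv_eq_one] at this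
  have hcomp : (lift x t hbraid).comp (fiberIncl n) = SemidirectProduct.inl := by
    ext1 i
    rw [MonoidHom.comp_apply, ← fiberElt_succ, fiberIncl_fiberElt (by omega), map_altQuot,
      lift_artinA, lift_artinB, hquot _ (by omega)]
  refine Function.Injective.of_comp (f := lift x t hbraid) ?_
  rw [← MonoidHom.coe_comp, hcomp]
  exact SemidirectProduct.inl_injective

/-- The product of the inclusions of the fiber and of the subgroup generated by `Δ²`. -/
def fiberProdIncl (n : ℕ) : FreeGroup (Fin (n - 1)) × Multiplicative ℤ →* ArtinTwo n :=
  (fiberIncl n).noncommCoprod (zpowersHom _ (artinDelta n ^ 2)) fun f z => by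
    rw [zpowersHom_apply]
    exact ((Subgroup.mem_center_iff.mp (zpow_mem (artinDelta_sq_mem_center n) _)) _)

lemma fiberProdIncl_apply (y : FreeGroup (Fin (n - 1)) × Multiplicative ℤ) :
    fiberProdIncl n y = fiberIncl n y.1 * (artinDelta n ^ 2) ^ y.2.toAdd := rfl

lemma fiberProdIncl_injective (hn : 2 < n) : Function.Injective (fiberProdIncl n) := by
  rw [injective_iff_map_eq_one]
  rintro ⟨f, z⟩ h
  rw [fiberProdIncl_apply] at h
  have hlen := congrArg (length n) h
  rw [map_mul, length_fiberIncl, one_mul, map_zpow, length_artinDelta_sq, map_one,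
    ← ofAdd_zsmul, ofAdd_eq_one, smul_eq_mul] at hlen
  have hz : z.toAdd = 0 := (mul_eq_zero.mp hlen).resolve_right (by positivity)
  simp only [hz, zpow_zero, mul_one] at h
  exact Prod.ext ((injective_iff_map_eq_one _).mp (fiberIncl_injective hn) f h) hz

lemma finiteIndex_range_fiberProdIncl (hn : 2 < n) : (fiberProdIncl n).range.FiniteIndex := by
  have : NeZero (2 * n) := ⟨by omega⟩
  let q : ArtinTwo n →* Multiplicative (ZMod (2 * n)) :=
    (Int.castAddHom (ZMod (2 * n))).toMultiplicative.comp (length n)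
  have hle : q.ker ≤ (fiberProdIncl n).range := by
    intro g hg
    have hg' : (((length n g).toAdd : ℤ) : ZMod (2 * n)) = 0 := hg
    obtain ⟨j, hj⟩ := (ZMod.intCast_zmod_eq_zero_iff_dvd _ _).mp hg'
    have hker : length n (g * ((artinDelta n ^ 2) ^ j)⁻¹) = 1 := by
      rw [map_mul, map_inv, map_zpow, length_artinDelta_sq, mul_inv_eq_one, ← ofAdd_zsmul,
        smul_eq_mul, mul_comm]
      apply Multiplicative.toAdd.injective
      rw [hj]
      push_cast [toAdd_ofAdd]
      ring
    obtain ⟨f, hf⟩ := mem_range_fiberIncl hn hker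
    exact ⟨(f, Multiplicative.ofAdd j), by simp [fiberProdIncl_apply, hf]⟩
  have : q.ker.FiniteIndex := Subgroup.finiteIndex_ker q
  exact Subgroup.finiteIndex_of_le hle

section LinearRepresentation

/-- An upper unitriangular matrix. -/
def upperUnip (c : ℝ) : Matrix.SpecialLinearGroup (Fin 2) ℝ := ⟨!![1, c; 0, 1], by simp⟩

/-- A lower unitriangular matrix. -/
def lowerUnip (c : ℝ) : Matrix.SpecialLinearGroup (Fin 2) ℝ := ⟨!![1, 0; c, 1], by simp⟩

/-- The quarter turn. -/
def quarterTurn : Matrix.SpecialLinearGroup (Fin 2) ℝ := ⟨!![0, 1; -1, 0], by simp⟩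

lemma coe_upperUnip (c : ℝ) : (upperUnip c : Matrix (Fin 2) (Fin 2) ℝ) = !![1, c; 0, 1] := rfl

lemma coe_lowerUnip (c : ℝ) : (lowerUnip c : Matrix (Fin 2) (Fin 2) ℝ) = !![1, 0; c, 1] := rfl

lemma coe_quarterTurn : (quarterTurn : Matrix (Fin 2) (Fin 2) ℝ) = !![0, 1; -1, 0] := rfl

lemma upperUnip_add (c d : ℝ) : upperUnip (c + d) = upperUnip c * upperUnip d := by
  apply Subtype.ext
  simp [coe_upperUnip, add_comm]

lemma lowerUnip_add (c d : ℝ) : lowerUnip (c + d) = lowerUnip c * lowerUnip d := by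
  apply Subtype.ext
  simp [coe_lowerUnip]

lemma upperUnip_zpow (c : ℝ) (m : ℤ) : upperUnip c ^ m = upperUnip (m * c) := by
  let f : Multiplicative ℝ →* Matrix.SpecialLinearGroup (Fin 2) ℝ :=
    MonoidHom.mk' (fun c => upperUnip c.toAdd) fun c d => upperUnip_add c.toAdd d.toAdd
  simpa [f] using (map_zpow f (Multiplicative.ofAdd c) m).symm

lemma lowerUnip_zpow (c : ℝ) (m : ℤ) : lowerUnip c ^ m = lowerUnip (m * c) := by
  let f : Multiplicative ℝ →* Matrix.SpecialLinearGroup (Fin 2) ℝ :=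
    MonoidHom.mk' (fun c => lowerUnip c.toAdd) fun c d => lowerUnip_add c.toAdd d.toAdd
  simpa [f] using (map_zpow f (Multiplicative.ofAdd c) m).symm

lemma mul_eq_zero_of_commute_upperUnip_lowerUnip {c d : ℝ}
    (h : Commute (upperUnip c) (lowerUnip d)) : c * d = 0 := by
  have := congrArg (fun M : Matrix.SpecialLinearGroup (Fin 2) ℝ =>
    (M : Matrix (Fin 2) (Fin 2) ℝ) 0 0) h.eq
  simpa [coe_upperUnip, coe_lowerUnip] using this

lemma sin_smul_rotation_pow (θ : ℝ) (k : ℕ) :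
    Real.sin θ • !![2 * Real.cos θ, -1; 1, 0] ^ k =
      !![Real.sin ((k + 1) * θ), -Real.sin (k * θ);
        Real.sin (k * θ), -Real.sin ((k - 1) * θ)] := by
  induction k with
  | zero =>
    ext i j
    fin_cases i <;> fin_cases j <;> simp
  | succ k ih =>
    rw [pow_succ, ← smul_mul_assoc, ih]
    have h1 : Real.sin ((k + 1 + 1) * θ) =
        Real.sin ((k + 1) * θ) * (2 * Real.cos θ) - Real.sin (k * θ) := by
      have e1 : ((k : ℝ) + 1 + 1) * θ = (k + 1) * θ + θ := by ring
      have e2 : (k : ℝ) * θ = (k + 1) * θ - θ := by ring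
      rw [e1, e2, Real.sin_add, Real.sin_sub]
      ring
    have h2 : Real.sin ((k + 1) * θ) =
        Real.sin (k * θ) * (2 * Real.cos θ) - Real.sin ((k - 1) * θ) := by
      have e1 : ((k : ℝ) + 1) * θ = k * θ + θ := by ring
      have e2 : ((k : ℝ) - 1) * θ = k * θ - θ := by ring
      rw [e1, e2, Real.sin_add, Real.sin_sub]
      ring
    ext i j
    fin_cases i <;> fin_cases j <;> simp [Matrix.mul_apply, Fin.sum_univ_two]
    · linarith
    · linarith

lemma rotation_pow_eq_neg_one (hn : 2 < n) :
    (!![2 * Real.cos (Real.pi / n), -1; 1, 0] : Matrix (Fin 2) (Fin 2) ℝ) ^ n = -1 := by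
  have hn0 : (n : ℝ) ≠ 0 := by positivity
  have hsin : 0 < Real.sin (Real.pi / n) := by
    apply Real.sin_pos_of_pos_of_lt_pi (by positivity)
    exact div_lt_self Real.pi_pos (by exact_mod_cast (by omega : 1 < n))
  have h := sin_smul_rotation_pow (Real.pi / n) n
  have e : (n : ℝ) * (Real.pi / n) = Real.pi := by field_simp
  rw [add_mul, sub_mul, one_mul, e, add_comm, Real.sin_add_pi, Real.sin_pi, Real.sin_pi_sub] at h
  apply smul_right_injective _ hsin.ne'
  dsimp only
  rw [h]
  ext i j
  fin_cases i <;> fin_cases j <;> simp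

lemma altG_unip (hn : 2 < n) :
    altG n (upperUnip (2 * Real.cos (Real.pi / n))) (lowerUnip (-(2 * Real.cos (Real.pi / n)))) =
      altG n (lowerUnip (-(2 * Real.cos (Real.pi / n))))
        (upperUnip (2 * Real.cos (Real.pi / n))) := by
  set c := 2 * Real.cos (Real.pi / n) with hc
  have hxy : SemiconjBy quarterTurn (upperUnip c) (lowerUnip (-c)) := by
    apply Subtype.ext
    simp [coe_quarterTurn, coe_upperUnip, coe_lowerUnip]
  have hyx : SemiconjBy quarterTurn (lowerUnip (-c)) (upperUnip c) := by
    apply Subtype.ext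
    simp [coe_quarterTurn, coe_upperUnip, coe_lowerUnip]
  have hprod : ((upperUnip c * quarterTurn : Matrix.SpecialLinearGroup (Fin 2) ℝ) :
      Matrix (Fin 2) (Fin 2) ℝ) = -!![c, -1; 1, 0] := by
    simp [coe_quarterTurn, coe_upperUnip]
  have hpow : Commute quarterTurn ((upperUnip c * quarterTurn) ^ n) := by
    apply Subtype.ext
    rw [Matrix.SpecialLinearGroup.coe_mul quarterTurn,
      Matrix.SpecialLinearGroup.coe_mul _ quarterTurn, Matrix.SpecialLinearGroup.coe_pow]
    rw [hprod, neg_pow, hc, rotation_pow_eq_neg_one hn]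
    rcases Nat.even_or_odd n with h | h <;> simp [h.neg_one_pow]
  rw [← altG_mul_pow hxy hyx] at hpow
  have hcomm : Commute quarterTurn
      (altG n (upperUnip c) (lowerUnip (-c))) := by
    simpa using hpow.mul_right ((Commute.refl quarterTurn).pow_right n).inv_right
  exact mul_right_cancel (hcomm.eq.symm.trans (hxy.altG hyx n).eq)

lemma two_mul_cos_ne_zero (hn : 2 < n) : 2 * Real.cos (Real.pi / n) ≠ 0 := by
  have hn' : (2 : ℝ) < n := by exact_mod_cast hn
  have : 0 < Real.cos (Real.pi / n) := by
    apply Real.cos_pos_of_mem_Ioo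
    have : 0 < Real.pi / n := by positivity
    exact ⟨by linarith [Real.pi_pos], div_lt_div_of_pos_left Real.pi_pos (by norm_num) hn'⟩
  positivity

lemma not_commute_artinA_zpow_artinB (hn : 2 < n) {m : ℤ} (hm : m ≠ 0) :
    ¬ Commute (artinA n ^ m) (artinB n) := by
  intro h
  have h := h.map (lift _ _ (altG_unip hn))
  rw [map_zpow, lift_artinA, lift_artinB, upperUnip_zpow] at h
  simpa [hm, two_mul_cos_ne_zero hn, -mul_eq_zero, mul_ne_zero] using
    mul_eq_zero_of_commute_upperUnip_lowerUnip h

lemma not_commute_artinA_artinB_zpow (hn : 2 < n) {m : ℤ} (hm : m ≠ 0) :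
    ¬ Commute (artinA n) (artinB n ^ m) := by
  intro h
  have h := h.map (lift _ _ (altG_unip hn))
  rw [map_zpow, lift_artinA, lift_artinB, lowerUnip_zpow] at h
  simpa [hm, two_mul_cos_ne_zero hn, -mul_eq_zero, mul_ne_zero] using
    mul_eq_zero_of_commute_upperUnip_lowerUnip h

end LinearRepresentation

end ArtinTwo

/-- for `n > 2` the Artin group `A_n` has a finite-index subgroup
isomorphic to `F_k × ℤ` with `k ≥ 2`, such that no nonzero power of `a` or of `b`
lies in the `ℤ` factor. -/
theorem artin_virtually_free_times_Z (n : ℕ) (hn : 2 < n) :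
    ∃ H : Subgroup (ArtinTwo n), H.FiniteIndex ∧
      ∃ k : ℕ, 2 ≤ k ∧ ∃ φ : H ≃* FreeGroup (Fin k) × Multiplicative ℤ,
        ∀ m : ℤ, m ≠ 0 →
          (∀ hmem : (artinA n) ^ m ∈ H, (φ ⟨(artinA n) ^ m, hmem⟩).1 ≠ 1) ∧
          (∀ hmem : (artinB n) ^ m ∈ H, (φ ⟨(artinB n) ^ m, hmem⟩).1 ≠ 1) := by
  refine ⟨(ArtinTwo.fiberProdIncl n).range, ArtinTwo.finiteIndex_range_fiberProdIncl hn,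
    n - 1, by omega, (MonoidHom.ofInjective (ArtinTwo.fiberProdIncl_injective hn)).symm, ?_⟩
  have hcenter (g : ArtinTwo n) (hmem : g ∈ (ArtinTwo.fiberProdIncl n).range)
      (h : ((MonoidHom.ofInjective (ArtinTwo.fiberProdIncl_injective hn)).symm ⟨g, hmem⟩).1 = 1) :
      g ∈ Subgroup.center (ArtinTwo n) := by
    have hg := MonoidHom.apply_ofInjective_symm (ArtinTwo.fiberProdIncl_injective hn) ⟨g, hmem⟩
    rw [ArtinTwo.fiberProdIncl_apply, h, map_one, one_mul] at hg
    change _ = g at hg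
    rw [← hg]
    exact zpow_mem (ArtinTwo.artinDelta_sq_mem_center n) _
  intro m hm
  exact ⟨fun hmem h => ArtinTwo.not_commute_artinA_zpow_artinB hn hm
      (Subgroup.mem_center_iff.mp (hcenter _ hmem h) _).symm,
    fun hmem h => ArtinTwo.not_commute_artinA_artinB_zpow hn hm
      (Subgroup.mem_center_iff.mp (hcenter _ hmem h) _)⟩
end

section
/- Let A be the Artin group on generators a, b, c with m_{ab} = 3, m_{bc} = 2, and m_{ac} ∈ {3,4,5}, and let Z be its centre (generated by Δ² if m_{ac} = 3 and by Δ otherwise). Then inside A, the intersection (A_{ab}·Z) ∩ (A_{bc}·Z) equals A_b·Z, where A_{ab}, A_{bc}, A_b are the special subgroups generated by {a,b}, {b,c}, {b} respectively. -/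
open scoped Pointwise

/-- The Artin relator for generators `i, j` with exponent `m`. -/
def artinRel {α : Type*} (i j : α) (m : ℕ) : FreeGroup α :=
  altG m (FreeGroup.of i) (FreeGroup.of j) * (altG m (FreeGroup.of j) (FreeGroup.of i))⁻¹

/-- The relators of the three-generator Artin group with
`m_{ab} = 3`, `m_{bc} = 2`, `m_{ac} = m`. -/
def rels3 (m : ℕ) : Set (FreeGroup (Fin 3)) :=
  {artinRel 0 1 3, artinRel 1 2 2, artinRel 0 2 m}

/-- The three-generator Artin group with `m_{ab} = 3`, `m_{bc} = 2`, `m_{ac} = m`. -/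
abbrev ArtinThree (m : ℕ) := PresentedGroup (rels3 m)

def genA (m : ℕ) : ArtinThree m := PresentedGroup.of 0
def genB (m : ℕ) : ArtinThree m := PresentedGroup.of 1
def genC (m : ℕ) : ArtinThree m := PresentedGroup.of 2

theorem altG_map {G H : Type*} [Monoid G] [Monoid H] (f : G →* H) (n : ℕ) (x y : G) :
    f (altG n x y) = altG n (f x) (f y) := by
  induction n generalizing x y with
  | zero => simp [altG]
  | succ n ih => simp [altG, ih]

theorem genB_mul_genC (m : ℕ) : genB m * genC m = genC m * genB m := by
  have h : PresentedGroup.mk (rels3 m) (artinRel 1 2 2) = 1 :=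
    PresentedGroup.mk_eq_one_iff.2 (Subgroup.subset_normalClosure (by simp [rels3]))
  rw [artinRel, map_mul, map_inv, mul_inv_eq_one, altG_map, altG_map] at h
  simp only [altG, mul_one] at h
  exact h

theorem exists_zpow_of_mem_closure_pair {G : Type*} [Group G] {x y g : G} (hxy : Commute x y)
    (hg : g ∈ Subgroup.closure {x, y}) : ∃ i j : ℤ, g = x ^ i * y ^ j := by
  induction hg using Subgroup.closure_induction with
  | mem g hg =>
    rcases hg with rfl | rfl
    · exact ⟨1, 0, by simp⟩
    · exact ⟨0, 1, by simp⟩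
  | one => exact ⟨0, 0, by simp⟩
  | mul g h _ _ hg hh =>
    obtain ⟨i, j, rfl⟩ := hg
    obtain ⟨k, l, rfl⟩ := hh
    exact ⟨i + k, j + l, by
      rw [zpow_add, zpow_add, mul_assoc, ← mul_assoc (y ^ j),
        ← (hxy.zpow_zpow k j).eq, mul_assoc, mul_assoc]⟩
  | inv g _ hg =>
    obtain ⟨i, j, rfl⟩ := hg
    exact ⟨-i, -j, by rw [mul_inv_rev, zpow_neg, zpow_neg,
      ← ((hxy.zpow_zpow i j).inv_inv).eq]⟩

/-- The images of the generators under the reduced Burau-type representation, i.e. the reflection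
representation of the Hecke algebra at `q = 2`, with parameter `κ = 4 cos² (π / m)`. -/
def burauMatrix (κ : ℝ) : Fin 3 → Matrix (Fin 3) (Fin 3) ℝ :=
  ![!![-2, 2, 2 * κ; 0, 1, 0; 0, 0, 1],
    !![1, 0, 0; 1, -2, 0; 0, 0, 1],
    !![1, 0, 0; 0, 1, 0; 1, 0, -2]]

theorem burauMatrix_det_ne_zero (κ : ℝ) (i : Fin 3) : (burauMatrix κ i).det ≠ 0 := by
  fin_cases i <;> simp [burauMatrix, Matrix.det_fin_three]

noncomputable def burauGL (κ : ℝ) (i : Fin 3) : GL (Fin 3) ℝ :=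
  Matrix.GeneralLinearGroup.mkOfDetNeZero (burauMatrix κ i) (burauMatrix_det_ne_zero κ i)

theorem burauGL_coe (κ : ℝ) (i : Fin 3) :
    (burauGL κ i : Matrix (Fin 3) (Fin 3) ℝ) = burauMatrix κ i := rfl

theorem coe_altG (n : ℕ) (x y : GL (Fin 3) ℝ) :
    ((altG n x y : GL (Fin 3) ℝ) : Matrix (Fin 3) (Fin 3) ℝ) = altG n x.val y.val :=
  altG_map (Units.coeHom _) n x y

theorem altG_burauMatrix_zero_one (κ : ℝ) :
    altG 3 (burauMatrix κ 0) (burauMatrix κ 1) = altG 3 (burauMatrix κ 1) (burauMatrix κ 0) := by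
  ext i j
  fin_cases i <;> fin_cases j <;>
    simp [altG, burauMatrix, Matrix.mul_apply, Fin.sum_univ_three]

theorem altG_burauMatrix_one_two (κ : ℝ) :
    altG 2 (burauMatrix κ 1) (burauMatrix κ 2) = altG 2 (burauMatrix κ 2) (burauMatrix κ 1) := by
  ext i j
  fin_cases i <;> fin_cases j <;>
    simp [altG, burauMatrix, Matrix.mul_apply, Fin.sum_univ_three]

theorem exists_altG_burauMatrix_zero_two {m : ℕ} (hm : m = 3 ∨ m = 4 ∨ m = 5) :
    ∃ κ : ℝ, 0 < κ ∧ κ < 3 ∧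
      altG m (burauMatrix κ 0) (burauMatrix κ 2) = altG m (burauMatrix κ 2) (burauMatrix κ 0) := by
  rcases hm with rfl | rfl | rfl
  · obtain ⟨κ, hκ⟩ : ∃ κ : ℝ, κ = 1 := ⟨1, rfl⟩
    refine ⟨κ, by linarith, by linarith, ?_⟩
    ext i j
    fin_cases i <;> fin_cases j <;>
      simp [altG, burauMatrix, Matrix.mul_apply, Fin.sum_univ_three] <;> grind
  · obtain ⟨κ, hκ⟩ : ∃ κ : ℝ, κ = 2 := ⟨2, rfl⟩
    refine ⟨κ, by linarith, by linarith, ?_⟩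
    ext i j
    fin_cases i <;> fin_cases j <;>
      simp [altG, burauMatrix, Matrix.mul_apply, Fin.sum_univ_three] <;> grind
  · obtain ⟨κ, h0, h3, hκ⟩ : ∃ κ : ℝ, 0 < κ ∧ κ < 3 ∧ κ ^ 2 = 3 * κ - 1 := by
      refine ⟨(3 + √5) / 2, by positivity, ?_, ?_⟩
      · have : √5 < 3 := by rw [Real.sqrt_lt' (by norm_num)]; norm_num
        linarith
      · linear_combination (Real.sq_sqrt (show (0 : ℝ) ≤ 5 by norm_num)) / 4
    refine ⟨κ, h0, h3, ?_⟩
    ext i j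
    fin_cases i <;> fin_cases j <;>
      simp [altG, burauMatrix, Matrix.mul_apply, Fin.sum_univ_three] <;> grind

/-- The representation of the Artin group with `ρ` of the generators given by `burauMatrix κ`. -/
theorem exists_burau_rep {m : ℕ} {κ : ℝ}
    (h : altG m (burauMatrix κ 0) (burauMatrix κ 2) =
      altG m (burauMatrix κ 2) (burauMatrix κ 0)) :
    ∃ ρ : ArtinThree m →* GL (Fin 3) ℝ, (ρ (genA m)).val = burauMatrix κ 0 ∧
      (ρ (genB m)).val = burauMatrix κ 1 ∧ (ρ (genC m)).val = burauMatrix κ 2 := by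
  have hrel : ∀ r ∈ rels3 m, FreeGroup.lift (burauGL κ) r = 1 := by
    rintro r (rfl | rfl | rfl) <;>
      rw [artinRel, map_mul, map_inv, mul_inv_eq_one, altG_map, altG_map] <;>
      simp only [FreeGroup.lift_apply_of] <;>
      apply Units.ext <;>
      simp only [coe_altG, burauGL_coe]
    · exact altG_burauMatrix_zero_one κ
    · exact altG_burauMatrix_one_two κ
    · exact h
  refine ⟨PresentedGroup.toGroup hrel, ?_, ?_, ?_⟩ <;>
    simp [genA, genB, genC, burauGL_coe]

/-- The vector spanning the common fixed space of the first two matrices. -/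
def fixedVec (κ : ℝ) : Fin 3 → ℝ := ![6 * κ, 2 * κ, 7]

theorem burauMatrix_zero_mulVec_fixedVec (κ : ℝ) :
    (burauMatrix κ 0).mulVec (fixedVec κ) = fixedVec κ := by
  ext i
  fin_cases i <;>
    simp [burauMatrix, fixedVec, Matrix.mulVec, dotProduct, Fin.sum_univ_three]
  ring

theorem burauMatrix_one_mulVec_fixedVec (κ : ℝ) :
    (burauMatrix κ 1).mulVec (fixedVec κ) = fixedVec κ := by
  ext i
  fin_cases i <;>
    simp [burauMatrix, fixedVec, Matrix.mulVec, dotProduct, Fin.sum_univ_three]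
  ring

theorem eq_smul_fixedVec {κ : ℝ} (w : Fin 3 → ℝ)
    (h0 : (burauMatrix κ 0).mulVec w = w) (h1 : (burauMatrix κ 1).mulVec w = w) :
    w = (w 2 / 7) • fixedVec κ := by
  have e0 := congrFun h0 0
  have e1 := congrFun h1 1
  simp [burauMatrix, Matrix.mulVec, dotProduct, Fin.sum_univ_three] at e0 e1
  ext i
  fin_cases i <;> simp [fixedVec] <;> linarith

theorem burauMatrix_two_pow_mulVec_fixedVec (κ : ℝ) (n : ℕ) :
    (burauMatrix κ 2 ^ n).mulVec (fixedVec κ) =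
      ![6 * κ, 2 * κ, 2 * κ + (7 - 2 * κ) * (-2) ^ n] := by
  induction n with
  | zero => simp [fixedVec]
  | succ n ih =>
    rw [pow_succ', ← Matrix.mulVec_mulVec, ih]
    ext i
    fin_cases i <;> simp [burauMatrix, Matrix.mulVec, dotProduct, Fin.sum_univ_three]
    ring

theorem mulVec_eq_of_mem_closure {G : Type*} [Group G] {n R : Type*} [Fintype n] [DecidableEq n]
    [CommRing R] (ρ : G →* GL n R) {S : Set G} {v : n → R}
    (hS : ∀ g ∈ S, (ρ g).val.mulVec v = v) {g : G} (hg : g ∈ Subgroup.closure S) :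
    (ρ g).val.mulVec v = v := by
  induction hg using Subgroup.closure_induction with
  | mem g hg => exact hS g hg
  | one => simp
  | mul g h _ _ hg hh => rw [map_mul, Units.val_mul, ← Matrix.mulVec_mulVec, hh, hg]
  | inv g _ hg =>
    nth_rewrite 1 [← hg]
    rw [Matrix.mulVec_mulVec, ← Units.val_mul, ← map_mul]
    simp

theorem eq_zero_of_genC_pow_mul_mem {m : ℕ} (hm : m = 3 ∨ m = 4 ∨ m = 5) {n : ℕ}
    {z : ArtinThree m} (hz : z ∈ Subgroup.center (ArtinThree m))
    (h : genC m ^ n * z ∈ Subgroup.closure {genA m, genB m}) : n = 0 := by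
  obtain ⟨κ, h0, h3, hκ⟩ := exists_altG_burauMatrix_zero_two hm
  obtain ⟨ρ, ha, hb, hc⟩ := exists_burau_rep hκ
  have hfix : ∀ g ∈ ({genA m, genB m} : Set (ArtinThree m)),
      (ρ g).val.mulVec (fixedVec κ) = fixedVec κ := by
    rintro g (rfl | rfl)
    · rw [ha, burauMatrix_zero_mulVec_fixedVec]
    · rw [hb, burauMatrix_one_mulVec_fixedVec]
  have hz_fix : ∀ g ∈ ({genA m, genB m} : Set (ArtinThree m)),
      (ρ g).val.mulVec ((ρ z).val.mulVec (fixedVec κ)) = (ρ z).val.mulVec (fixedVec κ) := by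
    intro g hg
    rw [Matrix.mulVec_mulVec, ← Units.val_mul, ← map_mul, Subgroup.mem_center_iff.1 hz g,
      map_mul, Units.val_mul, ← Matrix.mulVec_mulVec, hfix g hg]
  have hzv := eq_smul_fixedVec ((ρ z).val.mulVec (fixedVec κ))
    (by simpa [ha] using hz_fix (genA m) (by simp)) (by simpa [hb] using hz_fix (genB m) (by simp))
  have key := mulVec_eq_of_mem_closure ρ hfix h
  rw [map_mul, Units.val_mul, ← Matrix.mulVec_mulVec, hzv, Matrix.mulVec_smul, map_pow,
    Units.val_pow_eq_pow_val, hc, burauMatrix_two_pow_mulVec_fixedVec] at key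
  generalize (ρ z).val.mulVec (fixedVec κ) 2 / 7 = l at key
  have k0 := congrFun key 0
  have k2 := congrFun key 2
  simp only [fixedVec, Pi.smul_apply, smul_eq_mul, Matrix.cons_val] at k0 k2
  have hl : l = 1 := mul_right_cancel₀ (b := 6 * κ) (by positivity) (by linarith)
  have hpow : ((-2 : ℝ)) ^ n = 1 := by
    have : (7 - 2 * κ) * ((-2 : ℝ) ^ n - 1) = 0 := by rw [hl] at k2; linarith
    rcases mul_eq_zero.1 this with h | h <;> linarith
  by_contra hn
  have habs := congrArg abs hpow
  rw [abs_pow, abs_neg, abs_two, abs_one] at habs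
  exact (one_lt_pow₀ (by norm_num : (1 : ℝ) < 2) hn).ne' habs

theorem eq_zero_of_genC_zpow_mul_mem {m : ℕ} (hm : m = 3 ∨ m = 4 ∨ m = 5) {j : ℤ}
    {z : ArtinThree m} (hz : z ∈ Subgroup.center (ArtinThree m))
    (h : genC m ^ j * z ∈ Subgroup.closure {genA m, genB m}) : j = 0 := by
  obtain ⟨n, rfl | rfl⟩ := j.eq_nat_or_neg
  · rw [zpow_natCast] at h
    simpa using eq_zero_of_genC_pow_mul_mem hm hz h
  · have h' := inv_mem h
    rw [mul_inv_rev, ← Subgroup.mem_center_iff.1 (inv_mem hz), zpow_neg, inv_inv, zpow_natCast] at h'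
    simpa using eq_zero_of_genC_pow_mul_mem hm (inv_mem hz) h'

/-- for the Artin group with `m_{ab}=3`, `m_{bc}=2`, `m_{ac} ∈ {3,4,5}`
and centre `Z`, we have `A_{ab}Z ∩ A_{bc}Z = A_b Z`. -/
theorem artin3_coset_intersection (m : ℕ) (hm : m = 3 ∨ m = 4 ∨ m = 5) :
    ((Subgroup.closure {genA m, genB m} : Subgroup (ArtinThree m)) : Set (ArtinThree m)) *
        (Subgroup.center (ArtinThree m) : Set (ArtinThree m)) ∩
      ((Subgroup.closure {genB m, genC m} : Subgroup (ArtinThree m)) : Set (ArtinThree m)) *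
        (Subgroup.center (ArtinThree m) : Set (ArtinThree m)) =
    ((Subgroup.closure {genB m} : Subgroup (ArtinThree m)) : Set (ArtinThree m)) *
        (Subgroup.center (ArtinThree m) : Set (ArtinThree m)) := by
  apply Set.Subset.antisymm
  · rintro _ ⟨q, ⟨⟨p, hp, z, hz, hpq⟩, hq⟩, w, hw, rfl⟩
    obtain ⟨i, j, rfl⟩ := exists_zpow_of_mem_closure_pair (genB_mul_genC m) hq
    have hB : genB m ^ i ∈ Subgroup.closure {genA m, genB m} :=
      zpow_mem (Subgroup.subset_closure (by simp)) i
    have hpe : (genB m ^ i)⁻¹ * p = genC m ^ j * z⁻¹ := by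
      rw [eq_mul_inv_of_mul_eq hpq, mul_assoc, inv_mul_cancel_left]
    have hmem := mul_mem (inv_mem hB) hp
    rw [hpe] at hmem
    obtain rfl : j = 0 := eq_zero_of_genC_zpow_mul_mem hm (inv_mem hz) hmem
    have hBi : genB m ^ i ∈ Subgroup.closure {genB m} :=
      zpow_mem (Subgroup.mem_closure_singleton_self _) i
    exact ⟨genB m ^ i, hBi, w, hw, by simp⟩
  · rintro _ ⟨g, hg, w, hw, rfl⟩
    exact ⟨g, ⟨⟨g, Subgroup.closure_mono (by simp) hg, 1, one_mem _, mul_one g⟩,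
      Subgroup.closure_mono (by simp) hg⟩, w, hw, rfl⟩
end
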